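/- Let Y be a real Banach space. If Y has the approximate hyperplane sum property for ℓ∞⁴ with a function γ, then the pair (ℓ∞⁴, Y) has the Bishop–Phelps–Bollobás property for operators with the function η(ε) = γ(ε/3)². -/

import Mathlib

/-- `M_Y^4`: quadruples `(y₁,y₂,y₃,y₄)` in the closed unit ball of `Y` such that
`‖y_{i₁} − y_{i₂} + y_{i₃}‖ ≤ 1` for all `i₁ < i₂ < i₃`. -/
def MY4 {Y : Type*} [NormedAddCommGroup Y] (y : Fin 4 → Y) : Prop :=
  (∀ i, ‖y i‖ ≤ 1) ∧
    ∀ i j k : Fin 4, i < j → j < k → ‖y i - y j + y k‖ ≤ 1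

/-- `Y` has the approximate hyperplane sum property for `ℓ∞⁴` with the function `γ`. -/
def AHSpL4With (Y : Type*) [NormedAddCommGroup Y] [NormedSpace ℝ Y] (γ : ℝ → ℝ) : Prop :=
  ∀ ε : ℝ, 0 < ε → ε < 1 →
    (0 < γ ε ∧ γ ε < ε) ∧
    ∀ y : Fin 4 → Y, MY4 y →
      ∀ A : Finset (Fin 4), A.Nonempty →
        ∀ f : Y →L[ℝ] ℝ, ‖f‖ = 1 →
          (∀ i ∈ A, 1 - γ ε < f (y i)) →
          ∃ z : Fin 4 → Y, MY4 z ∧ (∀ i, ‖z i - y i‖ < ε) ∧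
            ‖∑ i ∈ A, z i‖ = (A.card : ℝ)

/-- The pair `(X, Y)` has the Bishop–Phelps–Bollobás property for operators with function `η`. -/
def BPBpWith (X Y : Type*) [NormedAddCommGroup X] [NormedSpace ℝ X]
    [NormedAddCommGroup Y] [NormedSpace ℝ Y] (η : ℝ → ℝ) : Prop :=
  ∀ ε : ℝ, 0 < ε → ε < 1 →
    (0 < η ε ∧ η ε < ε) ∧
    ∀ T : X →L[ℝ] Y, ‖T‖ = 1 → ∀ x₀ : X, ‖x₀‖ = 1 → 1 - η ε < ‖T x₀‖ →
      ∃ u₀ : X, ‖u₀‖ = 1 ∧ ∃ S : X →L[ℝ] Y, ‖S‖ = 1 ∧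
        ‖S u₀‖ = 1 ∧ ‖u₀ - x₀‖ < ε ∧ ‖S - T‖ < ε

namespace LInftyFour

/-- A linear map on `ℓ∞(ι)` is bounded by its values on sign vectors. -/
theorem norm_map_le_of_sign {ι Y : Type*} [Fintype ι] [NormedAddCommGroup Y] [NormedSpace ℝ Y]
    (φ : (ι → ℝ) →ₗ[ℝ] Y) {K : ℝ}
    (hφ : ∀ s : ι → ℝ, (∀ c, s c = 1 ∨ s c = -1) → ‖φ s‖ ≤ K) (x : ι → ℝ) :
    ‖φ x‖ ≤ K * ‖x‖ := by
  classical
  obtain ⟨g, hg, hgx⟩ := exists_dual_vector'' ℝ (φ x)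
  set a : ι → ℝ := fun c => g (φ (Pi.single c 1)) with ha
  have expand : ∀ t : ι → ℝ, g (φ t) = ∑ c, t c * a c := by
    intro t
    conv_lhs => rw [pi_eq_sum_univ' t]
    simp [ha, Pi.single]
  let s : ι → ℝ := fun c => if 0 ≤ a c then 1 else -1
  have hs : ∀ c, s c = 1 ∨ s c = -1 := fun c => by
    by_cases h : 0 ≤ a c <;> simp [s, h]
  have hsa : ∀ c, s c * a c = |a c| := fun c => by
    by_cases h : 0 ≤ a c
    · simp [s, h, abs_of_nonneg h]
    · simp [s, h, abs_of_neg (not_le.mp h)]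
  have hsum : ∑ c, |a c| ≤ K := by
    calc ∑ c, |a c| = g (φ s) := by
          rw [expand]
          exact Finset.sum_congr rfl fun c _ => (hsa c).symm
      _ ≤ ‖g (φ s)‖ := le_abs_self _
      _ ≤ ‖φ s‖ := g.le_of_opNorm_le_of_le hg le_rfl |>.trans (by simp)
      _ ≤ K := hφ s hs
  calc ‖φ x‖ = ∑ c, x c * a c := by rw [← expand]; simpa using hgx.symm
    _ ≤ ∑ c, ‖x‖ * |a c| := Finset.sum_le_sum fun c _ => by
        calc x c * a c ≤ |x c| * |a c| := by rw [← abs_mul]; exact le_abs_self _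
          _ ≤ ‖x‖ * |a c| := by gcongr; exact norm_le_pi_norm x c
    _ = (∑ c, |a c|) * ‖x‖ := by rw [← Finset.mul_sum, mul_comm]
    _ ≤ K * ‖x‖ := by gcongr

/-- The sign vectors `(-1, …, -1, 1, …, 1)` with `i` negative entries, a basis of `ℝ⁴`. -/
def stepVector (i : Fin 4) : Fin 4 → ℝ := fun c => if i ≤ c then 1 else -1

/-- The coordinates of a vector with respect to the basis `stepVector`. -/
noncomputable def stepCoord (x : Fin 4 → ℝ) : Fin 4 → ℝ :=
  ![(x 3 + x 0) / 2, (x 1 - x 0) / 2, (x 2 - x 1) / 2, (x 3 - x 2) / 2]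

theorem sum_stepCoord_smul_stepVector (x : Fin 4 → ℝ) :
    ∑ i, stepCoord x i • stepVector i = x := by
  ext c
  fin_cases c <;> simp [Fin.sum_univ_four, stepCoord, stepVector] <;> ring

theorem norm_stepVector (i : Fin 4) : ‖stepVector i‖ = 1 := by
  apply le_antisymm
  · rw [pi_norm_le_iff_of_nonneg zero_le_one]
    intro c
    unfold stepVector
    split_ifs <;> simp
  · simpa [stepVector, Fin.le_last i] using norm_le_pi_norm (stepVector i) i

variable {Y : Type*} [NormedAddCommGroup Y] [NormedSpace ℝ Y]

/-- The operator on `ℓ∞⁴` sending `stepVector i` to `w i`. -/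
noncomputable def stepOperator (w : Fin 4 → Y) : (Fin 4 → ℝ) →L[ℝ] Y :=
  LinearMap.toContinuousLinearMap
    { toFun := fun x => ∑ i, stepCoord x i • w i
      map_add' := fun x x' => by
        simp [Fin.sum_univ_four, stepCoord]
        module
      map_smul' := fun r x => by
        simp [Fin.sum_univ_four, stepCoord]
        module }

theorem stepOperator_apply (w : Fin 4 → Y) (x : Fin 4 → ℝ) :
    stepOperator w x = ∑ i, stepCoord x i • w i := rfl

theorem stepOperator_stepVector (w : Fin 4 → Y) (i : Fin 4) :
    stepOperator w (stepVector i) = w i := by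
  rw [stepOperator_apply]
  fin_cases i <;> simp [Fin.sum_univ_four, stepCoord, stepVector]

theorem stepOperator_map_stepVector (T : (Fin 4 → ℝ) →L[ℝ] Y) :
    stepOperator (fun i => T (stepVector i)) = T := by
  ext1 x
  conv_rhs => rw [← sum_stepCoord_smul_stepVector x]
  simp [stepOperator_apply]

theorem stepOperator_sub (w w' : Fin 4 → Y) :
    stepOperator (w - w') = stepOperator w - stepOperator w' := by
  ext1 x
  simp [stepOperator_apply, smul_sub]

/-- The sixteen sign vectors of `ℓ∞⁴` are, up to sign, the step vectors and their alternating
triple sums. -/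
theorem norm_stepOperator_le (w : Fin 4 → Y) {K : ℝ} (h1 : ∀ i, ‖w i‖ ≤ K)
    (h3 : ∀ i j k : Fin 4, i < j → j < k → ‖w i - w j + w k‖ ≤ K) : ‖stepOperator w‖ ≤ K := by
  have hK : 0 ≤ K := (norm_nonneg _).trans (h1 0)
  refine ContinuousLinearMap.opNorm_le_bound _ hK
    (norm_map_le_of_sign (stepOperator w).toLinearMap ?_)
  intro s hs
  have key : ∃ v : Y, ‖v‖ ≤ K ∧ (stepOperator w s = v ∨ stepOperator w s = -v) := by
    have e : stepOperator w s = ((s 3 + s 0) / 2) • w 0 + ((s 1 - s 0) / 2) • w 1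
        + ((s 2 - s 1) / 2) • w 2 + ((s 3 - s 2) / 2) • w 3 := by
      simp [stepOperator_apply, Fin.sum_univ_four, stepCoord]
    have h012 := h3 0 1 2 (by decide) (by decide)
    have h013 := h3 0 1 3 (by decide) (by decide)
    have h023 := h3 0 2 3 (by decide) (by decide)
    have h123 := h3 1 2 3 (by decide) (by decide)
    rw [e]
    rcases hs 0 with a | a <;> rcases hs 1 with b | b <;> rcases hs 2 with c | c <;>
      rcases hs 3 with d | d <;> rw [a, b, c, d] <;>
      first
      | exact ⟨_, h1 0, by first | (left; module) | (right; module)⟩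
      | exact ⟨_, h1 1, by first | (left; module) | (right; module)⟩
      | exact ⟨_, h1 2, by first | (left; module) | (right; module)⟩
      | exact ⟨_, h1 3, by first | (left; module) | (right; module)⟩
      | exact ⟨_, h012, by first | (left; module) | (right; module)⟩
      | exact ⟨_, h013, by first | (left; module) | (right; module)⟩
      | exact ⟨_, h023, by first | (left; module) | (right; module)⟩
      | exact ⟨_, h123, by first | (left; module) | (right; module)⟩
  obtain ⟨v, hv, h | h⟩ := key
  · simpa [h] using hv
  · simpa [h] using hv

theorem MY4_map_stepVector (T : (Fin 4 → ℝ) →L[ℝ] Y) (hT : ‖T‖ ≤ 1) :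
    MY4 fun i => T (stepVector i) := by
  refine ⟨fun i => ?_, fun i j k hij hjk => ?_⟩
  · simpa [norm_stepVector] using T.le_of_opNorm_le hT (stepVector i)
  · rw [← map_sub, ← map_add]
    refine (T.le_of_opNorm_le hT _).trans ?_
    rw [one_mul, pi_norm_le_iff_of_nonneg zero_le_one]
    intro c
    simp only [Pi.add_apply, Pi.sub_apply, stepVector]
    split_ifs <;> first | omega | norm_num

/-- Restricting a convex combination to indices carrying weight more than `1 - r` and normalizing
moves it by less than `2 * r`. -/
theorem norm_normalized_sum_sub_lt {ι E : Type*} [Fintype ι] [DecidableEq ι]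
    [NormedAddCommGroup E] [NormedSpace ℝ E] {l : ι → ℝ} (hl : ∀ i, 0 ≤ l i) (hl1 : ∑ i, l i = 1)
    {v : ι → E} (hv : ∀ i, ‖v i‖ ≤ 1) (A : Finset ι) {r : ℝ} (hr : r ≤ 1)
    (hA : 1 - r < ∑ i ∈ A, l i) :
    ‖∑ i ∈ A, (l i / ∑ j ∈ A, l j) • v i - ∑ i, l i • v i‖ < 2 * r := by
  set L := ∑ j ∈ A, l j with hL
  have hL0 : 0 < L := by linarith
  have hcompl : ∑ i ∈ Aᶜ, l i = 1 - L := by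
    rw [← hl1, ← Finset.sum_add_sum_compl A l]; ring
  have hL1 : L ≤ 1 := by
    have := Finset.sum_nonneg fun i (_ : i ∈ Aᶜ) => hl i
    linarith
  have bound : ∀ B : Finset ι, ‖∑ i ∈ B, l i • v i‖ ≤ ∑ i ∈ B, l i := fun B =>
    norm_sum_le_of_le B fun i _ => by
      rw [norm_smul, Real.norm_of_nonneg (hl i)]
      exact mul_le_of_le_one_right (hl i) (hv i)
  have e : ∑ i ∈ A, (l i / L) • v i - ∑ i, l i • v i
      = (L⁻¹ - 1) • ∑ i ∈ A, l i • v i - ∑ i ∈ Aᶜ, l i • v i := by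
    rw [← Finset.sum_add_sum_compl A, sub_smul, one_smul, Finset.smul_sum]
    simp only [smul_smul, div_eq_inv_mul]
    abel
  have hinv : 0 ≤ L⁻¹ - 1 := sub_nonneg.mpr ((one_le_inv₀ hL0).mpr hL1)
  calc _ ≤ ‖(L⁻¹ - 1) • ∑ i ∈ A, l i • v i‖ + ‖∑ i ∈ Aᶜ, l i • v i‖ := e ▸ norm_sub_le _ _
    _ ≤ (L⁻¹ - 1) * L + (1 - L) := by
        rw [norm_smul, Real.norm_of_nonneg hinv, ← hcompl]
        gcongr
        exacts [bound A, bound Aᶜ]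
    _ = 2 * (1 - L) := by field_simp; ring
    _ < 2 * r := by linarith

/-- If a convex combination of numbers at most `1` exceeds `1 - r ^ 2`, then the indices whose
number exceeds `1 - r` carry weight more than `1 - r`. -/
theorem one_sub_lt_sum_filter {ι : Type*} [Fintype ι] {l t : ι → ℝ} (hl : ∀ i, 0 ≤ l i)
    (hl1 : ∑ i, l i = 1) (ht : ∀ i, t i ≤ 1) {r : ℝ} (hr : 0 < r)
    (h : 1 - r ^ 2 < ∑ i, l i * t i) : 1 - r < ∑ i with 1 - r < t i, l i := by
  have hle : ∑ i, l i * t i ≤ ∑ i, ((1 - r) * l i + r * if 1 - r < t i then l i else 0) := by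
    refine Finset.sum_le_sum fun i _ => ?_
    split_ifs with hi
    · nlinarith [hl i, ht i]
    · nlinarith [hl i]
  rw [Finset.sum_add_distrib, ← Finset.mul_sum, ← Finset.mul_sum, hl1, ← Finset.sum_filter] at hle
  have : r * (1 - r) < r * ∑ i with 1 - r < t i, l i := by linarith
  exact lt_of_mul_lt_mul_left this hr.le

/-- The vectors of a finite family in the unit ball whose sum has maximal norm lie in a common
face. -/
theorem exists_dual_eq_one_of_norm_sum_eq_card {ι : Type*} {A : Finset ι} {z : ι → Y}
    (hz : ∀ i, ‖z i‖ ≤ 1) (h : ‖∑ i ∈ A, z i‖ = A.card) :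
    ∃ g : Y →L[ℝ] ℝ, ‖g‖ ≤ 1 ∧ ∀ i ∈ A, g (z i) = 1 := by
  obtain ⟨g, hg, hgz⟩ := exists_dual_vector'' ℝ (∑ i ∈ A, z i)
  refine ⟨g, hg, ?_⟩
  have hle : ∀ i ∈ A, g (z i) ≤ 1 := fun i _ =>
    (le_abs_self _).trans (by simpa using g.le_of_opNorm_le_of_le hg (hz i))
  refine (Finset.sum_eq_sum_iff_of_le hle).mp ?_
  rw [← map_sum, hgz]
  simp [h]

/-- The approximation for vectors in the simplex spanned by the step vectors. -/
theorem exists_approx_of_monotone {γ : ℝ → ℝ} (h : AHSpL4With Y γ) {ε : ℝ} (hε : 0 < ε)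
    (hε1 : ε < 1) (T : (Fin 4 → ℝ) →L[ℝ] Y) (hT : ‖T‖ = 1) {x : Fin 4 → ℝ} (hx : ‖x‖ = 1)
    (hmono : Monotone x) (hlast : x 3 = 1) (hTx : 1 - γ (ε / 3) ^ 2 < ‖T x‖) :
    ∃ u : Fin 4 → ℝ, ‖u‖ = 1 ∧ ∃ S : (Fin 4 → ℝ) →L[ℝ] Y, ‖S‖ = 1 ∧
      ‖S u‖ = 1 ∧ ‖u - x‖ < ε ∧ ‖S - T‖ < ε := by
  obtain ⟨⟨hγ, hγε⟩, hY⟩ := h (ε / 3) (by linarith) (by linarith)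
  set r := γ (ε / 3)
  have hTx0 : ‖T x‖ ≠ 0 := by
    refine ne_of_gt ?_
    nlinarith
  obtain ⟨f, hf, hfx⟩ := exists_dual_vector ℝ (T x) hTx0
  set l := stepCoord x with hl_def
  have hl : ∀ i, 0 ≤ l i := by
    have h0 := norm_le_pi_norm x 0
    rw [hx, Real.norm_eq_abs, abs_le] at h0
    have h01 : x 0 ≤ x 1 := hmono (by decide)
    have h12 : x 1 ≤ x 2 := hmono (by decide)
    have h23 : x 2 ≤ x 3 := hmono (by decide)
    intro i
    fin_cases i <;> simp [hl_def, stepCoord] <;> linarith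
  have hl1 : ∑ i, l i = 1 := by
    simp [hl_def, stepCoord, Fin.sum_univ_four, hlast]
    ring
  set y : Fin 4 → Y := fun i => T (stepVector i) with hy
  have hyM : MY4 y := MY4_map_stepVector T hT.le
  have hfy : ∀ i, f (y i) ≤ 1 := fun i =>
    (le_abs_self _).trans (by simpa using f.le_of_opNorm_le_of_le hf.le (hyM.1 i))
  have hTsum : T x = ∑ i, l i • y i := by
    conv_lhs => rw [← sum_stepCoord_smul_stepVector x]
    simp [hy, hl_def]
  have hsum : 1 - r ^ 2 < ∑ i, l i * f (y i) := by
    have : ∑ i, l i * f (y i) = ‖T x‖ := by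
      have h' : f (T x) = ‖T x‖ := by simpa using hfx
      rw [← h', hTsum]
      simp
    rwa [this]
  have hA := one_sub_lt_sum_filter hl hl1 hfy hγ hsum
  set A : Finset (Fin 4) := {i | 1 - r < f (y i)} with hA_def
  set L := ∑ i ∈ A, l i with hL
  have hL0 : 0 < L := by linarith
  have hAne : A.Nonempty := by
    rw [Finset.nonempty_iff_ne_empty]
    intro h0
    simp [hL, h0] at hL0
  obtain ⟨z, hzM, hzy, hzsum⟩ := hY y hyM A hAne f hf fun i hi => by simpa [hA_def] using hi
  obtain ⟨g, hg, hgz⟩ := exists_dual_eq_one_of_norm_sum_eq_card hzM.1 hzsum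
  have hweights : ∑ i ∈ A, l i / L = 1 := by rw [← Finset.sum_div, div_self hL0.ne']
  set u : Fin 4 → ℝ := ∑ i ∈ A, (l i / L) • stepVector i with hu_def
  have hu_le : ‖u‖ ≤ 1 := by
    rw [← hweights]
    refine norm_sum_le_of_le A fun i _ => ?_
    rw [norm_smul, norm_stepVector, mul_one, Real.norm_of_nonneg (div_nonneg (hl i) hL0.le)]
  have hu : ‖u‖ = 1 := by
    refine le_antisymm hu_le ?_
    have h3 : u 3 = 1 := by
      have : ∀ i : Fin 4, i ≤ 3 := Fin.le_last
      simp [hu_def, stepVector, this, hweights]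
    simpa [h3] using norm_le_pi_norm u 3
  have hS : ‖stepOperator z‖ ≤ 1 := norm_stepOperator_le z hzM.1 hzM.2
  have hSu : 1 ≤ ‖stepOperator z u‖ := by
    have hgS : g (stepOperator z u) = 1 := by
      rw [hu_def, map_sum, map_sum, ← hweights]
      refine Finset.sum_congr rfl fun i hi => ?_
      rw [map_smul, map_smul, stepOperator_stepVector, hgz i hi, smul_eq_mul, mul_one]
    simpa [hgS] using g.le_of_opNorm_le hg (stepOperator z u)
  have hSu' : ‖stepOperator z u‖ ≤ ‖stepOperator z‖ := by
    simpa [hu] using (stepOperator z).le_opNorm u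
  refine ⟨u, hu, stepOperator z, le_antisymm hS (hSu.trans hSu'),
    le_antisymm (hSu'.trans hS) hSu, ?_, ?_⟩
  · have := norm_normalized_sum_sub_lt hl hl1 (fun i => (norm_stepVector i).le) A
      (by linarith) hA
    rw [sum_stepCoord_smul_stepVector x] at this
    linarith
  · have hd : ‖z - y‖ < ε / 3 := (pi_norm_lt_iff (by linarith)).mpr hzy
    have hdi : ∀ i, ‖(z - y) i‖ ≤ ‖z - y‖ := norm_le_pi_norm _
    rw [← stepOperator_map_stepVector T, ← stepOperator_sub]
    refine (norm_stepOperator_le (K := 3 * ‖z - y‖) _ (fun i => ?_)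
      fun i j k _ _ => ?_).trans_lt (by linarith)
    · linarith [hdi i, norm_nonneg (z - y)]
    · refine (norm_add_le _ _).trans ?_
      linarith [norm_sub_le ((z - y) i) ((z - y) j), hdi i, hdi j, hdi k]

/-- A permutation of coordinates, as an isometry of `ℓ∞⁴`. -/
noncomputable def permIsometry (σ : Equiv.Perm (Fin 4)) : (Fin 4 → ℝ) ≃ₗᵢ[ℝ] (Fin 4 → ℝ) where
  toLinearEquiv := LinearEquiv.funCongrLeft ℝ ℝ σ
  norm_map' x := by
    refine le_antisymm ?_ ?_
    · exact (pi_norm_le_iff_of_nonneg (norm_nonneg x)).mpr fun c => norm_le_pi_norm x (σ c)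
    · refine (pi_norm_le_iff_of_nonneg (norm_nonneg _)).mpr fun c => ?_
      simpa using norm_le_pi_norm (LinearEquiv.funCongrLeft ℝ ℝ σ x) (σ.symm c)

theorem permIsometry_apply (σ : Equiv.Perm (Fin 4)) (x : Fin 4 → ℝ) :
    permIsometry σ x = x ∘ σ := rfl

/-- Every unit vector of `ℓ∞⁴` is isometrically equivalent to a monotone one ending in `1`. -/
theorem exists_isometry_monotone {x : Fin 4 → ℝ} (hx : ‖x‖ = 1) :
    ∃ e : (Fin 4 → ℝ) ≃ₗᵢ[ℝ] (Fin 4 → ℝ), Monotone (e x) ∧ e x 3 = 1 := by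
  have sorted : ∀ w : Fin 4 → ℝ, ‖w‖ = 1 → (∃ c, w c = 1) →
      ∃ e : (Fin 4 → ℝ) ≃ₗᵢ[ℝ] (Fin 4 → ℝ), Monotone (e w) ∧ e w 3 = 1 := by
    rintro w hw ⟨c, hc⟩
    have hmono : Monotone (w ∘ Tuple.sort w) := Tuple.monotone_sort w
    refine ⟨permIsometry (Tuple.sort w), hmono, le_antisymm ?_ ?_⟩
    · rw [permIsometry_apply]
      exact (le_abs_self _).trans (hw ▸ norm_le_pi_norm w _)
    · have := hmono (Fin.le_last ((Tuple.sort w).symm c))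
      simpa [hc, permIsometry_apply] using this
  obtain ⟨c, hc⟩ : ∃ c, |x c| = 1 := by
    by_contra! hne
    have hlt : ‖x‖ < 1 := (pi_norm_lt_iff one_pos).mpr fun c =>
      lt_of_le_of_ne (hx ▸ norm_le_pi_norm x c) (hne c)
    exact hlt.ne hx
  rcases (abs_eq zero_le_one).mp hc with h | h
  · exact sorted x hx ⟨c, h⟩
  · obtain ⟨e, he⟩ := sorted (-x) (by rwa [norm_neg]) ⟨c, by simp [h]⟩
    exact ⟨(LinearIsometryEquiv.neg ℝ).trans e, he⟩

end LInftyFour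

/-- If `Y` has the AHSp-`ℓ∞⁴` with function `γ`, then the pair `(ℓ∞⁴, Y)` has the BPBp
with the function `η(ε) = γ(ε/3)²`. -/
theorem stmt1 (Y : Type*) [NormedAddCommGroup Y] [NormedSpace ℝ Y] [CompleteSpace Y]
    (γ : ℝ → ℝ) (h : AHSpL4With Y γ) :
    BPBpWith (Fin 4 → ℝ) Y (fun ε => (γ (ε / 3)) ^ 2) := by
  intro ε hε hε1
  obtain ⟨hγ, hγε⟩ := (h (ε / 3) (by linarith) (by linarith)).1
  refine ⟨⟨by positivity, by dsimp only; nlinarith⟩, fun T hT x hx hTx => ?_⟩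
  obtain ⟨e, hmono, hlast⟩ := LInftyFour.exists_isometry_monotone hx
  have norm_comp : ∀ (R : (Fin 4 → ℝ) →L[ℝ] Y) (i : (Fin 4 → ℝ) ≃ₗᵢ[ℝ] (Fin 4 → ℝ)),
      ‖R.comp (i.toContinuousLinearEquiv : (Fin 4 → ℝ) →L[ℝ] (Fin 4 → ℝ))‖ = ‖R‖ :=
    fun R i => R.opNorm_comp_linearIsometryEquiv i
  obtain ⟨u, hu, S, hS, hSu, hux, hST⟩ := LInftyFour.exists_approx_of_monotone h hε hε1
    (T.comp (e.symm.toContinuousLinearEquiv : (Fin 4 → ℝ) →L[ℝ] (Fin 4 → ℝ)))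
    (by rw [norm_comp, hT]) (x := e x) (by simpa using hx) hmono hlast (by simpa using hTx)
  refine ⟨e.symm u, by simpa using hu,
    S.comp (e.toContinuousLinearEquiv : (Fin 4 → ℝ) →L[ℝ] (Fin 4 → ℝ)),
    by rw [norm_comp, hS], by simpa using hSu, ?_, ?_⟩
  · rw [← e.norm_map]
    simpa using hux
  · rw [← norm_comp _ e.symm]
    convert hST using 2
    ext1 v
    simp
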